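/- Let α ∈ (0,2). The function Ψ : (0,1) → ℝ satisfies lim_{a→0⁺} Ψ(a) = ∞ and lim_{a→1⁻} Ψ(a) = ∞. -/

import Mathlib

open MeasureTheory Real Filter Set

/-- Euler Beta function `B(x,y) = ∫₀¹ t^(x-1) (1-t)^(y-1) dt`. -/
noncomputable def betaFn (x y : ℝ) : ℝ :=
  ∫ t in (0:ℝ)..1, t ^ (x - 1) * (1 - t) ^ (y - 1)

/-- `C_α = π⁻¹ sin(π α / 2)`. -/
noncomputable def Cc (α : ℝ) : ℝ := Real.sin (Real.pi * α / 2) / Real.pi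

/-- `T_α = B(α, 1 - α/2)`. -/
noncomputable def Tc (α : ℝ) : ℝ := betaFn α (1 - α / 2)

/-- Poisson kernel of the fractional Laplacian for the interval `(a,1)`:
`P_{(a,1)}(x,y) = C_α (((x-a)(1-x))/((y-a)(y-1)))^(α/2) |x-y|⁻¹`. -/
noncomputable def Pker (α a x y : ℝ) : ℝ :=
  Cc α * (((x - a) * (1 - x)) / ((y - a) * (y - 1))) ^ (α / 2) * |x - y|⁻¹

/-- `fseq α a n` is `f_a^{(n+1)}`: `f_a^{(1)}(x) = ∫_{-a}^a P_{(a,1)}(x,y) dy` and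
`f_a^{(n)}(x) = ∫_a^1 P_{(a,1)}(x,-y) f_a^{(n-1)}(y) dy` for `n ≥ 2`. -/
noncomputable def fseq (α a : ℝ) : ℕ → ℝ → ℝ
  | 0 => fun x => ∫ y in (-a)..a, Pker α a x y
  | n + 1 => fun x => ∫ y in a..(1:ℝ), Pker α a x (-y) * fseq α a n y

/-- `f_a(x) = Σ_{n=1}^∞ f_a^{(n)}(x)`. -/
noncomputable def ff (α a x : ℝ) : ℝ := ∑' n : ℕ, fseq α a n x

/-- `Φ(a,y) = ((y-a)(y-1))^(-α/2) |y-a|⁻¹`. -/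
noncomputable def Phi (α a y : ℝ) : ℝ :=
  ((y - a) * (y - 1)) ^ (-(α / 2)) * |y - a|⁻¹

/-- `Ψ(a) = C_α (1-a)^(α/2) (∫_1^∞ Φ(a,y) dy + ∫_a^∞ Φ(a,-y) dy - ∫_a^1 Φ(a,-y) f_a(y) dy)`. -/
noncomputable def Psi (α a : ℝ) : ℝ :=
  Cc α * (1 - a) ^ (α / 2) *
    ((∫ y in Set.Ioi (1:ℝ), Phi α a y) + (∫ y in Set.Ioi a, Phi α a (-y))
      - ∫ y in a..(1:ℝ), Phi α a (-y) * ff α a y)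

/-- The function `z⁻¹ (1 + p/z)^(-s) (1 - q/z)^(-s)`. For `p, q > 0` and `s ∈ (0,1)` it maps the
upper half-plane to the lower half-plane. -/
noncomputable def nevanlinna (p q s : ℝ) (z : ℂ) : ℂ :=
  Complex.exp (-(Complex.log z + s * Complex.log (1 + p / z) + s * Complex.log (1 - q / z)))

lemma im_one_add_div (p : ℝ) (z : ℂ) : (1 + p / z : ℂ).im = -(p * z.im / Complex.normSq z) := by
  simp [Complex.div_im]

lemma im_one_sub_div (q : ℝ) (z : ℂ) : (1 - q / z : ℂ).im = q * z.im / Complex.normSq z := by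
  simp [Complex.div_im]

lemma normSq_pos_of_im_pos {z : ℂ} (hz : 0 < z.im) : 0 < Complex.normSq z :=
  Complex.normSq_pos.2 fun h => by simp [h] at hz

lemma im_one_add_div_neg {p : ℝ} (hp : 0 < p) {z : ℂ} (hz : 0 < z.im) :
    (1 + p / z : ℂ).im < 0 := by
  have := normSq_pos_of_im_pos hz
  rw [im_one_add_div]
  have : 0 < p * z.im / Complex.normSq z := by positivity
  linarith

lemma im_one_sub_div_pos {q : ℝ} (hq : 0 < q) {z : ℂ} (hz : 0 < z.im) :
    0 < (1 - q / z : ℂ).im := by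
  have := normSq_pos_of_im_pos hz
  rw [im_one_sub_div]
  positivity

lemma differentiableAt_nevanlinna {p q : ℝ} (s : ℝ) (hp : 0 < p) (hq : 0 < q) {z : ℂ}
    (hz : 0 < z.im) : DifferentiableAt ℂ (nevanlinna p q s) z := by
  have h0 : z ≠ 0 := fun h => by simp [h] at hz
  have h1 : z ∈ Complex.slitPlane := Or.inr hz.ne'
  have h2 : (1 + p / z : ℂ) ∈ Complex.slitPlane := Or.inr (im_one_add_div_neg hp hz).ne
  have h3 : (1 - q / z : ℂ) ∈ Complex.slitPlane := Or.inr (im_one_sub_div_pos hq hz).ne'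
  unfold nevanlinna
  have e2 : DifferentiableAt ℂ (fun z : ℂ => Complex.log (1 + p / z)) z :=
    DifferentiableAt.clog (by fun_prop (disch := assumption)) h2
  have e3 : DifferentiableAt ℂ (fun z : ℂ => Complex.log (1 - q / z)) z :=
    DifferentiableAt.clog (by fun_prop (disch := assumption)) h3
  have e1 := Complex.differentiableAt_log h1
  fun_prop

lemma sin_arg_add_arg_pos {z w : ℂ} (h : 0 < (w * z).im) :
    0 < Real.sin (Complex.arg w + Complex.arg z) := by
  have hw : w ≠ 0 := fun h' => by simp [h'] at h
  have hz : z ≠ 0 := fun h' => by simp [h'] at h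
  have key : (w * z).im = ‖w‖ * ‖z‖ * Real.sin (Complex.arg w + Complex.arg z) := by
    rw [Real.sin_add, Complex.mul_im]
    have a := Complex.norm_mul_cos_arg w
    have b := Complex.norm_mul_sin_arg w
    have c := Complex.norm_mul_cos_arg z
    have d := Complex.norm_mul_sin_arg z
    linear_combination (-z.im) * a + (-z.re) * b - ‖w‖ * Real.cos w.arg * d
      - ‖w‖ * Real.sin w.arg * c
  rw [key] at h
  have : 0 < ‖w‖ * ‖z‖ := by positivity
  exact (pos_iff_pos_of_mul_pos h).1 this

lemma nevanlinna_im_neg {p q s : ℝ} (hp : 0 < p) (hq : 0 < q) (hs : s ∈ Ioo (0 : ℝ) 1) {z : ℂ}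
    (hz : 0 < z.im) : (nevanlinna p q s z).im < 0 := by
  have h0 : z ≠ 0 := fun h => by simp [h] at hz
  have hθ : 0 < z.arg ∧ z.arg < π := by
    have h1 : 0 ≤ z.arg := Complex.arg_nonneg_iff.2 hz.le
    refine ⟨lt_of_le_of_ne h1 fun h => ?_, Complex.arg_lt_pi_iff.2 (Or.inr hz.ne')⟩
    have := (Complex.arg_eq_zero_iff.1 h.symm).2
    exact hz.ne' this
  have h1 : (1 + p / z : ℂ).arg < 0 := Complex.arg_neg_iff.2 (im_one_add_div_neg hp hz)
  have h1' := Complex.neg_pi_lt_arg (1 + p / z : ℂ)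
  have h2 : 0 ≤ (1 - q / z : ℂ).arg := Complex.arg_nonneg_iff.2 (im_one_sub_div_pos hq hz).le
  have h2' := Complex.arg_le_pi (1 - q / z : ℂ)
  have s1 : 0 < Real.sin ((1 + p / z : ℂ).arg + z.arg) := by
    apply sin_arg_add_arg_pos
    have : (1 + p / z : ℂ) * z = z + p := by field_simp
    rw [this]; simpa using hz
  have s2 : 0 < Real.sin ((1 - q / z : ℂ).arg + z.arg) := by
    apply sin_arg_add_arg_pos
    have : (1 - q / z : ℂ) * z = z - q := by field_simp
    rw [this]; simpa using hz
  have t1 : 0 < (1 + p / z : ℂ).arg + z.arg := by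
    by_contra! h
    exact absurd (Real.sin_nonpos_of_nonpos_of_neg_pi_le h (by linarith)) (not_le.2 s1)
  have t2 : (1 - q / z : ℂ).arg + z.arg < π := by
    by_contra! h
    have := Real.sin_nonpos_of_nonpos_of_neg_pi_le (x := (1 - q / z : ℂ).arg + z.arg - 2 * π)
      (by linarith) (by linarith)
    rw [Real.sin_sub_two_pi] at this
    linarith
  obtain ⟨hs0, hs1⟩ := hs
  have him : (-(Complex.log z + s * Complex.log (1 + p / z) + s * Complex.log (1 - q / z))).im
      = -(z.arg + s * (1 + p / z : ℂ).arg + s * (1 - q / z : ℂ).arg) := by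
    simp only [Complex.neg_im, Complex.add_im, Complex.mul_im, Complex.log_im, Complex.ofReal_re,
      Complex.ofReal_im, zero_mul, add_zero]
  rw [nevanlinna, Complex.exp_im, him]
  refine mul_neg_of_pos_of_neg (Real.exp_pos _) (Real.sin_neg_of_neg_of_neg_pi_lt ?_ ?_)
  · nlinarith
  · nlinarith

lemma tendsto_mul_nevanlinna (p q s : ℝ) :
    Tendsto (fun z : ℂ => Complex.exp (-(s * Complex.log (1 + p / z)
      + s * Complex.log (1 - q / z)))) (Bornology.cobounded ℂ) (nhds 1) := by
  have h : Tendsto (fun w : ℂ => Complex.exp (-(s * Complex.log (1 + p * w)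
      + s * Complex.log (1 - q * w)))) (nhds 0) (nhds 1) := by
    have : ContinuousAt (fun w : ℂ => Complex.exp (-(s * Complex.log (1 + p * w)
      + s * Complex.log (1 - q * w)))) 0 := by
      have e1 : ContinuousAt (fun w : ℂ => Complex.log (1 + p * w)) 0 :=
        ContinuousAt.clog (by fun_prop) (by simp)
      have e2 : ContinuousAt (fun w : ℂ => Complex.log (1 - q * w)) 0 :=
        ContinuousAt.clog (by fun_prop) (by simp)
      fun_prop
    simpa [ContinuousAt] using this
  exact h.comp (tendsto_inv₀_cobounded (α := ℂ))

lemma exists_norm_nevanlinna_sub_inv_le (p q s : ℝ) {δ : ℝ} (hδ : 0 < δ) :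
    ∃ R₀ : ℝ, ∀ z : ℂ, z ≠ 0 → R₀ ≤ ‖z‖ → ‖nevanlinna p q s z - z⁻¹‖ ≤ δ / ‖z‖ := by
  have h := (tendsto_mul_nevanlinna p q s).eventually (Metric.ball_mem_nhds 1 hδ)
  rw [← comap_norm_atTop, eventually_comap] at h
  obtain ⟨R₀, hR⟩ := eventually_atTop.1 h
  refine ⟨R₀, fun z hz hzR => ?_⟩
  have h1 := hR _ hzR z rfl
  rw [dist_eq_norm] at h1
  have : nevanlinna p q s z = z⁻¹ * Complex.exp (-(s * Complex.log (1 + p / z)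
      + s * Complex.log (1 - q / z))) := by
    rw [nevanlinna, add_assoc, neg_add, Complex.exp_add, Complex.exp_neg, Complex.exp_log hz]
  rw [this, ← mul_sub_one, norm_mul, norm_inv, div_eq_inv_mul δ]
  exact mul_le_mul_of_nonneg_left h1.le (by positivity)

lemma norm_integral_nevanlinna_sub_inv_le {p q : ℝ} (s : ℝ) (hp : 0 < p) (hq : 0 < q) {δ R ε : ℝ}
    (hδ : 0 < δ) (hε : 0 < ε) (hR : ε ≤ R)
    (h : ∀ z : ℂ, z ≠ 0 → R ≤ ‖z‖ → ‖nevanlinna p q s z - z⁻¹‖ ≤ δ / ‖z‖) :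
    ‖∫ x in (-R)..R, (nevanlinna p q s (x + ε * Complex.I) - (x + ε * Complex.I : ℂ)⁻¹)‖
      ≤ 4 * δ := by
  have hR0 : 0 < R := hε.trans_le hR
  have hb : ∀ z : ℂ, R ≤ ‖z‖ → ‖nevanlinna p q s z - z⁻¹‖ ≤ δ / R := fun z hz =>
    (h z (norm_pos_iff.1 (hR0.trans_le hz)) hz).trans (by gcongr)
  have key := Complex.integral_boundary_rect_eq_zero_of_differentiableOn
    (fun z => nevanlinna p q s z - z⁻¹) (-R + ε * Complex.I) (R + R * Complex.I) (by
      intro z hz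
      have hz1 : 0 < z.im := by
        have := hz.2
        simp [uIcc_of_le hR] at this
        linarith
      have h0 : z ≠ 0 := fun h => by simp [h] at hz1
      exact ((differentiableAt_nevanlinna s hp hq hz1).sub
        (differentiableAt_inv h0)).differentiableWithinAt)
  simp only [Complex.add_re, Complex.neg_re, Complex.ofReal_re, Complex.mul_re, Complex.I_re,
    Complex.I_im, Complex.ofReal_im, Complex.add_im, Complex.neg_im, Complex.mul_im, mul_zero,
    mul_one, sub_self, add_zero, neg_zero, zero_add, Complex.ofReal_neg] at key
  have b1 : ‖∫ x in (-R)..R, (nevanlinna p q s (x + R * Complex.I) - (x + R * Complex.I : ℂ)⁻¹)‖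
      ≤ δ / R * |R - -R| := by
    refine intervalIntegral.norm_integral_le_of_norm_le_const fun x _ => hb _ ?_
    have := Complex.abs_im_le_norm (x + R * Complex.I : ℂ)
    simp only [Complex.add_im, Complex.ofReal_im, Complex.mul_im, Complex.ofReal_re, Complex.I_im,
      Complex.I_re, mul_one, mul_zero, add_zero, zero_add] at this
    exact (le_abs_self R).trans this
  have b2 : ‖∫ y in ε..R, (nevanlinna p q s (R + y * Complex.I) - (R + y * Complex.I : ℂ)⁻¹)‖
      ≤ δ / R * |R - ε| := by
    refine intervalIntegral.norm_integral_le_of_norm_le_const fun x _ => hb _ ?_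
    have := Complex.abs_re_le_norm (R + x * Complex.I : ℂ)
    simp only [Complex.add_re, Complex.ofReal_im, Complex.mul_re, Complex.ofReal_re, Complex.I_im,
      Complex.I_re, mul_one, mul_zero, add_zero, sub_self] at this
    exact (le_abs_self R).trans this
  have b3 : ‖∫ y in ε..R, (nevanlinna p q s (-R + y * Complex.I) - (-R + y * Complex.I : ℂ)⁻¹)‖
      ≤ δ / R * |R - ε| := by
    refine intervalIntegral.norm_integral_le_of_norm_le_const fun x _ => hb _ ?_
    have := Complex.abs_re_le_norm (-R + x * Complex.I : ℂ)
    simp only [Complex.add_re, Complex.neg_re, Complex.ofReal_im, Complex.mul_re,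
      Complex.ofReal_re, Complex.I_im, abs_neg,
      Complex.I_re, mul_one, mul_zero, add_zero, sub_self] at this
    exact (le_abs_self R).trans this
  have c1 : δ / R * |R - -R| = 2 * δ := by
    rw [abs_of_pos (by linarith)]; field_simp; ring
  have c2 : δ / R * |R - ε| ≤ δ := by
    rw [abs_of_nonneg (by linarith)]
    calc δ / R * (R - ε) ≤ δ / R * R := by gcongr; linarith
      _ = δ := by field_simp
  rw [c1] at b1
  set J0 := ∫ x in (-R)..R, (nevanlinna p q s (x + ε * Complex.I) - (x + ε * Complex.I : ℂ)⁻¹)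
  set J1 := ∫ x in (-R)..R, (nevanlinna p q s (x + R * Complex.I) - (x + R * Complex.I : ℂ)⁻¹)
  set J2 := ∫ y in ε..R, (nevanlinna p q s (R + y * Complex.I) - (R + y * Complex.I : ℂ)⁻¹)
  set J3 := ∫ y in ε..R, (nevanlinna p q s (-R + y * Complex.I) - (-R + y * Complex.I : ℂ)⁻¹)
  have e : J0 = J1 - Complex.I • J2 + Complex.I • J3 := by linear_combination key
  rw [e]
  calc _ ≤ ‖J1‖ + ‖Complex.I • J2‖ + ‖Complex.I • J3‖ :=
        (norm_add_le _ _).trans (by gcongr; exact norm_sub_le _ _)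
    _ = ‖J1‖ + ‖J2‖ + ‖J3‖ := by simp
    _ ≤ 4 * δ := by linarith

lemma integral_neg_im_inv_le {ε : ℝ} (hε : 0 < ε) (R : ℝ) :
    ∫ x in (-R)..R, -((x + ε * Complex.I : ℂ)⁻¹).im ≤ π := by
  have hd : ∀ x : ℝ, HasDerivAt (fun x : ℝ => Real.arctan (x / ε))
      (-((x + ε * Complex.I : ℂ)⁻¹).im) x := by
    intro x
    have := ((hasDerivAt_id x).div_const ε).arctan
    refine this.congr_deriv ?_
    have him : ((x + ε * Complex.I : ℂ)⁻¹).im = -ε / (x * x + ε * ε) := by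
      rw [Complex.inv_im, Complex.normSq_apply]
      simp
    have h1 : 0 < x * x + ε * ε := by nlinarith [mul_self_nonneg x, mul_pos hε hε]
    have h2 : 0 < 1 + (x / ε) ^ 2 := by positivity
    rw [him, id]
    field_simp
    ring
  have hc : Continuous fun x : ℝ => -((x + ε * Complex.I : ℂ)⁻¹).im := by
    refine (Complex.continuous_im.comp (Continuous.inv₀ (by fun_prop) fun x h => ?_)).neg
    have := congrArg Complex.im h
    simp at this
    exact hε.ne' this
  rw [intervalIntegral.integral_eq_sub_of_hasDerivAt (fun x _ => hd x)
    (hc.intervalIntegrable _ _)]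
  have h1 := Real.arctan_lt_pi_div_two (R / ε)
  have h2 := Real.neg_pi_div_two_lt_arctan (-R / ε)
  linarith

lemma continuous_nevanlinna_line {p q : ℝ} (s : ℝ) (hp : 0 < p) (hq : 0 < q) {ε : ℝ}
    (hε : 0 < ε) : Continuous fun x : ℝ => nevanlinna p q s (x + ε * Complex.I) := by
  refine continuous_iff_continuousAt.2 fun x => ?_
  have := (differentiableAt_nevanlinna s hp hq
    (z := (x + ε * Complex.I : ℂ)) (by simpa using hε)).continuousAt
  exact ContinuousAt.comp' (f := fun x : ℝ => (x + ε * Complex.I : ℂ)) this (by fun_prop)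

lemma integral_neg_im_nevanlinna_le {p q s : ℝ} (hp : 0 < p) (hq : 0 < q)
    (hs : s ∈ Ioo (0 : ℝ) 1) {ε : ℝ} (hε : 0 < ε) :
    ∫ x in (-p)..q, -(nevanlinna p q s (x + ε * Complex.I)).im ≤ π := by
  refine le_of_forall_pos_le_add fun η hη => ?_
  obtain ⟨R₀, hR₀⟩ := exists_norm_nevanlinna_sub_inv_le p q s (δ := η / 4) (by positivity)
  set R := max R₀ (max ε (max p q))
  have r1 : ε ≤ R := (le_max_left _ _).trans (le_max_right _ _)
  have r2 : p ≤ R := (le_max_left _ _).trans ((le_max_right _ _).trans (le_max_right _ _))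
  have r3 : q ≤ R := (le_max_right _ _).trans ((le_max_right _ _).trans (le_max_right _ _))
  have hG := norm_integral_nevanlinna_sub_inv_le s hp hq (δ := η / 4) (by positivity) hε r1
    fun z hz hzR => hR₀ z hz ((le_max_left _ _).trans hzR)
  have hc := continuous_nevanlinna_line s hp hq hε
  have hci : Continuous fun x : ℝ => (x + ε * Complex.I : ℂ)⁻¹ := by
    refine Continuous.inv₀ (by fun_prop) fun x h => ?_
    have := congrArg Complex.im h
    simp at this
    exact hε.ne' this
  have hcF : Continuous fun x : ℝ => -(nevanlinna p q s (x + ε * Complex.I)).im :=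
    (Complex.continuous_im.comp hc).neg
  have hcI : Continuous fun x : ℝ => -((x + ε * Complex.I : ℂ)⁻¹).im :=
    (Complex.continuous_im.comp hci).neg
  calc ∫ x in (-p)..q, -(nevanlinna p q s (x + ε * Complex.I)).im
      ≤ ∫ x in (-R)..R, -(nevanlinna p q s (x + ε * Complex.I)).im := by
        refine intervalIntegral.integral_mono_interval (by linarith) (by linarith) r3
          (Eventually.of_forall fun x => ?_) (hcF.intervalIntegrable _ _)
        have := nevanlinna_im_neg hp hq hs (z := (x + ε * Complex.I : ℂ)) (by simpa using hε)
        simp only [Pi.zero_apply]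
        linarith
    _ = (∫ x in (-R)..R, -((x + ε * Complex.I : ℂ)⁻¹).im)
        - (∫ x in (-R)..R,
          (nevanlinna p q s (x + ε * Complex.I) - (x + ε * Complex.I : ℂ)⁻¹)).im := by
        have : (∫ x in (-R)..R,
            (nevanlinna p q s (x + ε * Complex.I) - (x + ε * Complex.I : ℂ)⁻¹)).im
            = ∫ x in (-R)..R,
            (nevanlinna p q s (x + ε * Complex.I) - (x + ε * Complex.I : ℂ)⁻¹).im :=
          (intervalIntegral.intervalIntegral_im
            ((hc.sub hci).intervalIntegrable _ _)).symm
        have hcS : Continuous fun x : ℝ =>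
            (nevanlinna p q s (x + ε * Complex.I) - (x + ε * Complex.I : ℂ)⁻¹).im :=
          Complex.continuous_im.comp (hc.sub hci)
        rw [this, ← intervalIntegral.integral_sub (hcI.intervalIntegrable _ _)
          (hcS.intervalIntegrable _ _)]
        congr 1
        ext x
        simp only [Complex.sub_im]
        ring
    _ ≤ π + η := by
        have h1 := integral_neg_im_inv_le hε R
        have h2 := (Complex.abs_im_le_norm _).trans hG
        have h3 := (abs_le.1 h2).1
        linarith

lemma tendsto_neg_im_nevanlinna {p q s t : ℝ} (hp : 0 < p) (hq : 0 < q)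
    (ht : t ∈ Ioo (-p) q) (ht0 : t ≠ 0) :
    Tendsto (fun ε : ℝ => -(nevanlinna p q s (t + ε * Complex.I)).im) (nhdsWithin 0 (Ioi 0))
      (nhds (Real.sin (π * s) * (|t|⁻¹ * ((1 + p / t) * (q / t - 1)) ^ (-s)))) := by
  have htC : (t : ℂ) ≠ 0 := by exact_mod_cast ht0
  have hz : Tendsto (fun ε : ℝ => (t + ε * Complex.I : ℂ)) (nhdsWithin 0 (Ioi 0)) (nhds t) := by
    have : Continuous fun ε : ℝ => (t + ε * Complex.I : ℂ) := by fun_prop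
    simpa using (this.tendsto 0).mono_left nhdsWithin_le_nhds
  have hz1 : Tendsto (fun ε : ℝ => (1 + p / (t + ε * Complex.I) : ℂ)) (nhdsWithin 0 (Ioi 0))
      (nhds ((1 + p / t : ℝ) : ℂ)) := by
    push_cast
    exact tendsto_const_nhds.add (tendsto_const_nhds.div hz htC)
  have hz2 : Tendsto (fun ε : ℝ => (1 - q / (t + ε * Complex.I) : ℂ)) (nhdsWithin 0 (Ioi 0))
      (nhds ((1 - q / t : ℝ) : ℂ)) := by
    push_cast
    exact tendsto_const_nhds.sub (tendsto_const_nhds.div hz htC)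
  have him : ∀ᶠ ε : ℝ in nhdsWithin 0 (Ioi 0), 0 < (t + ε * Complex.I : ℂ).im :=
    eventually_nhdsWithin_of_forall fun ε hε => by simpa using hε
  have main : ∀ θ : ℝ, Real.sin θ = Real.sin (π * s) → (1 + p / t) * (q / t - 1) > 0 →
      Tendsto (fun ε : ℝ => Complex.log (t + ε * Complex.I)
        + s * Complex.log (1 + p / (t + ε * Complex.I))
        + s * Complex.log (1 - q / (t + ε * Complex.I))) (nhdsWithin 0 (Ioi 0))
        (nhds ((Real.log t + s * Real.log (1 + p / t) + s * Real.log (1 - q / t) : ℝ)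
          + θ * Complex.I)) →
      Tendsto (fun ε : ℝ => -(nevanlinna p q s (t + ε * Complex.I)).im) (nhdsWithin 0 (Ioi 0))
      (nhds (Real.sin (π * s) * (|t|⁻¹ * ((1 + p / t) * (q / t - 1)) ^ (-s)))) := by
    intro θ hθ hpos h
    have h1 := (Complex.continuous_im.tendsto _).comp
      ((Complex.continuous_exp.tendsto _).comp h.neg)
    have h1 := h1.neg
    have ha : (1 + p / t) ≠ 0 := left_ne_zero_of_mul hpos.ne'
    have hb : (q / t - 1) ≠ 0 := right_ne_zero_of_mul hpos.ne'
    have hlog : Real.log (1 - q / t) = Real.log (q / t - 1) := by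
      rw [← Real.log_neg_eq_log, neg_sub]
    have hlim : -(Complex.exp (-((Real.log t + s * Real.log (1 + p / t)
        + s * Real.log (1 - q / t) : ℝ) + θ * Complex.I))).im
        = Real.sin (π * s) * (|t|⁻¹ * ((1 + p / t) * (q / t - 1)) ^ (-s)) := by
      have e1 : (-(((Real.log t + s * Real.log (1 + p / t)
        + s * Real.log (1 - q / t) : ℝ) : ℂ) + θ * Complex.I)).re
        = -Real.log t + Real.log ((1 + p / t) * (q / t - 1)) * (-s) := by
        rw [Real.log_mul ha hb, hlog]
        simp only [Complex.neg_re, Complex.add_re, Complex.ofReal_re, Complex.mul_re,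
          Complex.ofReal_im, Complex.I_re, Complex.I_im, mul_zero, zero_mul, sub_zero, add_zero]
        ring
      have e2 : (-(((Real.log t + s * Real.log (1 + p / t)
        + s * Real.log (1 - q / t) : ℝ) : ℂ) + θ * Complex.I)).im = -θ := by
        simp only [Complex.neg_im, Complex.add_im, Complex.ofReal_im, Complex.mul_im,
          Complex.ofReal_re, Complex.I_re, Complex.I_im, mul_zero, mul_one, zero_add, add_zero]
      rw [Complex.exp_im, e1, e2, Real.sin_neg, hθ, Real.exp_add, Real.exp_neg,
        Real.exp_log_eq_abs ht0, ← Real.rpow_def_of_pos hpos]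
      ring
    rw [← hlim]
    exact h1
  rcases lt_or_gt_of_ne ht0 with hneg | hpos
  · have e1 : 1 + p / t < 0 := by
      have : (t + p) / t < 0 := div_neg_of_pos_of_neg (by linarith [ht.1]) hneg
      rwa [add_div, div_self ht0] at this
    have e2 : 0 < 1 - q / t := by
      have : q / t < 0 := div_neg_of_pos_of_neg hq hneg
      linarith
    have l0 := (Complex.tendsto_log_nhdsWithin_im_nonneg_of_re_neg_of_im_zero
      (z := (t : ℂ)) (by simpa using hneg) (by simp)).comp
      (tendsto_nhdsWithin_iff.2 ⟨hz, him.mono fun ε h => h.le⟩)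
    have l1 := (Complex.tendsto_log_nhdsWithin_im_neg_of_re_neg_of_im_zero
      (z := ((1 + p / t : ℝ) : ℂ)) (by simpa using e1) (by simp)).comp
      (tendsto_nhdsWithin_iff.2 ⟨hz1, him.mono fun ε h => im_one_add_div_neg hp h⟩)
    have l2 := (continuousAt_clog (x := ((1 - q / t : ℝ) : ℂ))
      (Complex.ofReal_mem_slitPlane.2 e2)).tendsto.comp hz2
    refine main (π - π * s) (Real.sin_pi_sub _) ?_ ?_
    · nlinarith
    · convert (l0.add (l1.const_mul (s : ℂ))).add (l2.const_mul (s : ℂ)) using 1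
      congr 1
      rw [Complex.norm_real, Complex.norm_real, ← Complex.ofReal_log e2.le]
      simp only [Real.norm_eq_abs, Real.log_abs]
      push_cast
      ring_nf
  · have e1 : 0 < 1 + p / t := by positivity
    have e2 : 1 - q / t < 0 := by
      have : (t - q) / t < 0 := div_neg_of_neg_of_pos (by linarith [ht.2]) hpos
      rwa [sub_div, div_self ht0] at this
    have l0 := (continuousAt_clog (x := (t : ℂ))
      (Complex.ofReal_mem_slitPlane.2 hpos)).tendsto.comp hz
    have l1 := (continuousAt_clog (x := ((1 + p / t : ℝ) : ℂ))
      (Complex.ofReal_mem_slitPlane.2 e1)).tendsto.comp hz1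
    have l2 := (Complex.tendsto_log_nhdsWithin_im_nonneg_of_re_neg_of_im_zero
      (z := ((1 - q / t : ℝ) : ℂ)) (by simpa using e2) (by simp)).comp
      (tendsto_nhdsWithin_iff.2 ⟨hz2, him.mono fun ε h => (im_one_sub_div_pos hq h).le⟩)
    refine main (π * s) rfl ?_ ?_
    · nlinarith
    · convert (l0.add (l1.const_mul (s : ℂ))).add (l2.const_mul (s : ℂ)) using 1
      congr 1
      rw [Complex.norm_real, ← Complex.ofReal_log hpos.le, ← Complex.ofReal_log e1.le]
      simp only [Real.norm_eq_abs, Real.log_abs]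
      push_cast
      ring_nf

lemma lintegral_boundary_density_le {p q s : ℝ} (hp : 0 < p) (hq : 0 < q)
    (hs : s ∈ Ioo (0 : ℝ) 1) :
    ∫⁻ t in Ioo (-p) q \ {0}, ENNReal.ofReal
      (Real.sin (π * s) * (|t|⁻¹ * ((1 + p / t) * (q / t - 1)) ^ (-s))) ≤ ENNReal.ofReal π := by
  set ε : ℕ → ℝ := fun n => 1 / ((n : ℝ) + 1)
  have hε : ∀ n, 0 < ε n := fun n => by positivity
  have hε0 : Tendsto ε atTop (nhdsWithin 0 (Ioi 0)) :=
    tendsto_nhdsWithin_iff.2 ⟨tendsto_one_div_add_atTop_nhds_zero_nat, Eventually.of_forall hε⟩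
  set u : ℕ → ℝ → ℝ := fun n t => -(nevanlinna p q s (t + ε n * Complex.I)).im
  have hu : ∀ n, Continuous (u n) := fun n =>
    (Complex.continuous_im.comp (continuous_nevanlinna_line s hp hq (hε n))).neg
  have hm : MeasurableSet (Ioo (-p) q \ {0}) := measurableSet_Ioo.diff (measurableSet_singleton 0)
  calc _ = ∫⁻ t in Ioo (-p) q \ {0}, liminf (fun n => ENNReal.ofReal (u n t)) atTop := by
        refine setLIntegral_congr_fun hm fun t ht => ?_
        have := (tendsto_neg_im_nevanlinna (s := s) hp hq ht.1 ht.2).comp hε0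
        exact (ENNReal.tendsto_ofReal this).liminf_eq.symm
    _ ≤ liminf (fun n => ∫⁻ t in Ioo (-p) q \ {0}, ENNReal.ofReal (u n t)) atTop :=
        lintegral_liminf_le fun n => (hu n).measurable.ennreal_ofReal
    _ ≤ liminf (fun _ : ℕ => ENNReal.ofReal π) atTop := by
        refine liminf_le_liminf (Eventually.of_forall fun n => ?_)
        calc _ ≤ ∫⁻ t in Ioc (-p) q, ENNReal.ofReal (u n t) :=
              lintegral_mono_set (sdiff_subset.trans Ioo_subset_Ioc_self)
          _ = ENNReal.ofReal (∫ t in Ioc (-p) q, u n t) := by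
              refine (ofReal_integral_eq_lintegral_ofReal ?_ (Eventually.of_forall fun t => ?_)).symm
              · exact ((hu n).intervalIntegrable (-p) q).1
              · have := nevanlinna_im_neg hp hq hs (z := (t + ε n * Complex.I : ℂ))
                  (by simpa using hε n)
                simp only [Pi.zero_apply, u]
                linarith
          _ ≤ ENNReal.ofReal π := by
              rw [← intervalIntegral.integral_of_le (by linarith)]
              exact ENNReal.ofReal_le_ofReal (integral_neg_im_nevanlinna_le hp hq hs (hε n))
    _ = ENNReal.ofReal π := by simp

lemma Cc_pos {α : ℝ} (hα : α ∈ Ioo (0 : ℝ) 2) : 0 < Cc α := by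
  refine div_pos (Real.sin_pos_of_pos_of_lt_pi ?_ ?_) Real.pi_pos
  · have := mul_pos Real.pi_pos hα.1
    positivity
  · nlinarith [Real.pi_pos, hα.2]

lemma mul_pos_of_notMem_Icc {a y : ℝ} (ha : a < 1) (hy : y ∈ (Icc a 1)ᶜ) :
    0 < (y - a) * (y - 1) := by
  rcases lt_or_ge y a with h | h
  · nlinarith
  · have : 1 < y := by
      by_contra! h'
      exact hy ⟨h, h'⟩
    exact mul_pos (by linarith) (by linarith)

lemma Pker_nonneg {α a x y : ℝ} (hα : α ∈ Ioo (0 : ℝ) 2) (hx : x ∈ Ioo a 1)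
    (hy : y ∈ (Icc a 1)ᶜ) : 0 ≤ Pker α a x y := by
  have h1 := mul_pos_of_notMem_Icc (hx.1.trans hx.2) hy
  have h2 : 0 < (x - a) * (1 - x) := mul_pos (by linarith [hx.1]) (by linarith [hx.2])
  have h3 := Cc_pos hα
  unfold Pker
  positivity

lemma measurable_Pker (α a : ℝ) : Measurable fun z : ℝ × ℝ => Pker α a z.1 z.2 := by
  unfold Pker
  fun_prop

lemma lintegral_Pker_le_one {α a x : ℝ} (hα : α ∈ Ioo (0 : ℝ) 2) (hx : x ∈ Ioo a 1) :
    ∫⁻ y in (Icc a 1)ᶜ, ENNReal.ofReal (Pker α a x y) ≤ 1 := by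
  have hxa : 0 < x - a := sub_pos.2 hx.1
  have hx1 : 0 < 1 - x := sub_pos.2 hx.2
  set p := (x - a)⁻¹ with hp
  set q := (1 - x)⁻¹ with hq
  have hp0 : 0 < p := inv_pos.2 hxa
  have hq0 : 0 < q := inv_pos.2 hx1
  set S := Ioo (-p) q \ {0} with hS
  have hm : MeasurableSet S := measurableSet_Ioo.diff (measurableSet_singleton 0)
  have himg : (Icc a 1)ᶜ ⊆ (fun t => x + t⁻¹) '' S := by
    intro y hy
    have hyx : y - x ≠ 0 := fun h => hy (by
      have : y = x := by linarith
      exact this ▸ Ioo_subset_Icc_self hx)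
    refine ⟨(y - x)⁻¹, ⟨⟨?_, ?_⟩, by simpa using hyx⟩, by simp⟩
    · rcases lt_or_gt_of_ne hyx with h | h
      · have hya : y < a := by
          by_contra! h'
          exact hy ⟨h', by linarith⟩
        rw [neg_lt, ← inv_neg]
        exact inv_strictAnti₀ hxa (by linarith)
      · exact (neg_lt_zero.2 hp0).trans (inv_pos.2 h)
    · rcases lt_or_gt_of_ne hyx with h | h
      · exact (inv_lt_zero.2 h).trans hq0
      · have hya : 1 < y := by
          by_contra! h'
          exact hy ⟨by linarith, h'⟩
        exact inv_strictAnti₀ hx1 (by linarith)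
  have hpt : ∀ t ∈ S, ENNReal.ofReal |-(t ^ 2)⁻¹| * ENNReal.ofReal (Pker α a x (x + t⁻¹))
      = ENNReal.ofReal π⁻¹ * ENNReal.ofReal (Real.sin (π * (α / 2)) *
        (|t|⁻¹ * ((1 + p / t) * (q / t - 1)) ^ (-(α / 2)))) := by
    intro t ht
    have ht0 : t ≠ 0 := ht.2
    have hpos : 0 < (1 + p / t) * (q / t - 1) := by
      have : (1 + p / t) * (q / t - 1) = (t + p) * (q - t) / t ^ 2 := by field_simp
      rw [this]
      have h1 : 0 < t + p := by linarith [ht.1.1]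
      have h2 : 0 < q - t := by linarith [ht.1.2]
      positivity
    rw [← ENNReal.ofReal_mul (abs_nonneg _), ← ENNReal.ofReal_mul (by positivity)]
    congr 1
    have hr : (x - a) * (1 - x) / ((x + t⁻¹ - a) * (x + t⁻¹ - 1))
        = ((1 + p / t) * (q / t - 1))⁻¹ := by
      have : (1 + p / t) * (q / t - 1)
          = ((x + t⁻¹ - a) * (x + t⁻¹ - 1)) / ((x - a) * (1 - x)) := by
        rw [hp, hq]; field_simp; ring
      rw [this, inv_div]
    unfold Pker Cc
    rw [hr, Real.inv_rpow hpos.le, ← Real.rpow_neg hpos.le, sub_add_cancel_left, abs_neg, abs_neg,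
      abs_inv, abs_inv, inv_inv, abs_pow, mul_div_assoc]
    have : |t| ≠ 0 := abs_ne_zero.2 ht0
    field_simp
  calc _ ≤ ∫⁻ y in (fun t => x + t⁻¹) '' S, ENNReal.ofReal (Pker α a x y) :=
        lintegral_mono_set himg
    _ = ∫⁻ t in S, ENNReal.ofReal |-(t ^ 2)⁻¹| * ENNReal.ofReal (Pker α a x (x + t⁻¹)) := by
        refine lintegral_image_eq_lintegral_abs_deriv_mul hm (fun t ht => ?_) ?_ _
        · exact ((hasDerivAt_inv ht.2).const_add x).hasDerivWithinAt
        · intro t _ u _ h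
          simpa using h
    _ = ENNReal.ofReal π⁻¹ * ∫⁻ t in S, ENNReal.ofReal (Real.sin (π * (α / 2)) *
        (|t|⁻¹ * ((1 + p / t) * (q / t - 1)) ^ (-(α / 2)))) := by
        rw [setLIntegral_congr_fun hm hpt, lintegral_const_mul _ (by fun_prop)]
    _ ≤ ENNReal.ofReal π⁻¹ * ENNReal.ofReal π := by
        gcongr
        exact lintegral_boundary_density_le hp0 hq0 ⟨by linarith [hα.1], by linarith [hα.2]⟩
    _ = 1 := by
        rw [← ENNReal.ofReal_mul (by positivity), inv_mul_cancel₀ Real.pi_ne_zero,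
          ENNReal.ofReal_one]

lemma integrableOn_Pker {α a x : ℝ} (hα : α ∈ Ioo (0 : ℝ) 2) (hx : x ∈ Ioo a 1) :
    IntegrableOn (Pker α a x) (Icc a 1)ᶜ := by
  refine ⟨((measurable_Pker α a).comp measurable_prodMk_left).aestronglyMeasurable, ?_⟩
  rw [hasFiniteIntegral_iff_ofReal ((ae_restrict_iff' measurableSet_Icc.compl).2
    (Eventually.of_forall fun y hy => Pker_nonneg hα hx hy))]
  exact (lintegral_Pker_le_one hα hx).trans_lt ENNReal.one_lt_top

lemma integral_Pker_le_one {α a x : ℝ} (hα : α ∈ Ioo (0 : ℝ) 2) (hx : x ∈ Ioo a 1) :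
    ∫ y in (Icc a 1)ᶜ, Pker α a x y ≤ 1 := by
  have h := ofReal_integral_eq_lintegral_ofReal (integrableOn_Pker hα hx)
    ((ae_restrict_iff' measurableSet_Icc.compl).2
    (Eventually.of_forall fun y hy => Pker_nonneg hα hx hy))
  have h2 := lintegral_Pker_le_one hα hx
  rw [← h] at h2
  exact ENNReal.ofReal_le_one.1 h2

/-- A lower bound for the probability of leaving `(a,1)` from `x` by a jump into `(2,3)`. -/
noncomputable def exitBound (α a x : ℝ) : ℝ :=
  Cc α * (((x - a) * (1 - x)) / 6) ^ (α / 2) * 3⁻¹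

lemma exitBound_nonneg {α a x : ℝ} (hα : α ∈ Ioo (0 : ℝ) 2) (hx : x ∈ Ioo a 1) :
    0 ≤ exitBound α a x := by
  have h2 : 0 < (x - a) * (1 - x) := mul_pos (by linarith [hx.1]) (by linarith [hx.2])
  have h3 := Cc_pos hα
  unfold exitBound
  positivity

lemma exitBound_le_integral {α a x : ℝ} (hα : α ∈ Ioo (0 : ℝ) 2) (ha : 0 < a)
    (hx : x ∈ Ioo a 1) : exitBound α a x ≤ ∫ y in Ioc 2 3, Pker α a x y := by
  have hsub : Ioc (2 : ℝ) 3 ⊆ (Icc a 1)ᶜ := fun y hy h => by linarith [hy.1, h.2]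
  have h2 : 0 < (x - a) * (1 - x) := mul_pos (by linarith [hx.1]) (by linarith [hx.2])
  have hC := Cc_pos hα
  calc exitBound α a x = ∫ y in Ioc (2 : ℝ) 3, exitBound α a x := by
        simp only [integral_const, measureReal_restrict_apply_univ, Real.volume_real_Ioc]
        norm_num
    _ ≤ _ := by
        refine setIntegral_mono_on (by simp) ((integrableOn_Pker hα hx).mono_set hsub)
          measurableSet_Ioc fun y hy => ?_
        have hy1 : 0 < y - a := by linarith [hy.1, hx.1, hx.2]
        have hy2 : 0 < y - 1 := by linarith [hy.1]
        have hα2 : 0 ≤ α / 2 := by linarith [hα.1]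
        unfold exitBound Pker
        have hd : (y - a) * (y - 1) ≤ 6 := by nlinarith [hy.1, hy.2]
        have hxy : |x - y| ≤ 3 := abs_le.2 ⟨by linarith [hy.2, hx.1], by linarith [hx.2, hy.1]⟩
        have hxy0 : 0 < |x - y| := abs_pos.2 (by linarith [hx.2, hy.1])
        gcongr

lemma Pker_mass_split {α a x : ℝ} (hα : α ∈ Ioo (0 : ℝ) 2) (ha : 0 < a) (hx : x ∈ Ioo a 1) :
    (∫ y in (-a)..a, Pker α a x y) + (∫ y in Ioo a 1, Pker α a x (-y)) + exitBound α a x ≤ 1 := by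
  have ha1 : a < 1 := hx.1.trans hx.2
  have hi := integrableOn_Pker hα hx
  have s1 : Ioo (-a) a ⊆ (Icc a 1)ᶜ := fun y hy h => by linarith [hy.2, h.1]
  have s2 : Ioc (-1) (-a) ⊆ (Icc a 1)ᶜ := fun y hy h => by linarith [hy.2, h.1]
  have s3 : Ioc (2 : ℝ) 3 ⊆ (Icc a 1)ᶜ := fun y hy h => by linarith [hy.1, h.2]
  have e1 : ∫ y in (-a)..a, Pker α a x y = ∫ y in Ioo (-a) a, Pker α a x y := by
    rw [intervalIntegral.integral_of_le (by linarith), integral_Ioc_eq_integral_Ioo]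
  have e2 : ∫ y in Ioo a 1, Pker α a x (-y) = ∫ y in Ioc (-1) (-a), Pker α a x y := by
    rw [← integral_Ioc_eq_integral_Ioo, ← intervalIntegral.integral_of_le ha1.le,
      intervalIntegral.integral_comp_neg, intervalIntegral.integral_of_le (by linarith)]
  have d1 : Disjoint (Ioo (-a) a) (Ioc (-1) (-a)) :=
    Set.disjoint_left.2 fun y h h' => by linarith [h.1, h'.2]
  have d2 : Disjoint (Ioo (-a) a ∪ Ioc (-1) (-a)) (Ioc 2 3) :=
    Set.disjoint_left.2 fun y h h' => by
      rcases h with h | h <;> linarith [h.2, h'.1]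
  calc _ ≤ (∫ y in Ioo (-a) a, Pker α a x y) + (∫ y in Ioc (-1) (-a), Pker α a x y)
        + ∫ y in Ioc 2 3, Pker α a x y := by
        rw [e1, e2]
        gcongr
        exact exitBound_le_integral hα ha hx
    _ = ∫ y in (Ioo (-a) a ∪ Ioc (-1) (-a)) ∪ Ioc 2 3, Pker α a x y := by
        rw [setIntegral_union d2 measurableSet_Ioc ((hi.mono_set s1).union (hi.mono_set s2))
          (hi.mono_set s3), setIntegral_union d1 measurableSet_Ioc (hi.mono_set s1)
          (hi.mono_set s2)]
    _ ≤ ∫ y in (Icc a 1)ᶜ, Pker α a x y := by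
        refine setIntegral_mono_set hi ((ae_restrict_iff' measurableSet_Icc.compl).2
          (Eventually.of_forall fun y hy => Pker_nonneg hα hx hy)) ?_
        exact (union_subset (union_subset s1 s2) s3).eventuallyLE
    _ ≤ 1 := integral_Pker_le_one hα hx

lemma integrableOn_Pker_neg {α a x : ℝ} (hα : α ∈ Ioo (0 : ℝ) 2) (ha : 0 < a)
    (hx : x ∈ Ioo a 1) : IntegrableOn (fun y => Pker α a x (-y)) (Ioo a 1) := by
  have s2 : Ioo (-1) (-a) ⊆ (Icc a 1)ᶜ := fun y hy h => by linarith [hy.2, h.1]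
  have := ((integrableOn_Pker hα hx).mono_set s2).comp_neg
  simpa using this

lemma Pker_neg_nonneg {α a x y : ℝ} (hα : α ∈ Ioo (0 : ℝ) 2) (ha : 0 < a)
    (hx : x ∈ Ioo a 1) (hy : y ∈ Ioo a 1) : 0 ≤ Pker α a x (-y) :=
  Pker_nonneg hα hx fun h => by linarith [h.1, hy.1]

lemma fseq_zero_eq {α a : ℝ} (ha : 0 < a) (x : ℝ) :
    fseq α a 0 x = ∫ y in Ioo (-a) a, Pker α a x y := by
  rw [← integral_Ioc_eq_integral_Ioo, ← intervalIntegral.integral_of_le (by linarith)]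
  rfl

lemma fseq_succ_eq {α a : ℝ} (ha : a ≤ 1) (n : ℕ) (x : ℝ) :
    fseq α a (n + 1) x = ∫ y in Ioo a 1, Pker α a x (-y) * fseq α a n y := by
  rw [← integral_Ioc_eq_integral_Ioo, ← intervalIntegral.integral_of_le ha]
  rfl

lemma measurable_fseq {α a : ℝ} (ha0 : 0 < a) (ha : a < 1) (n : ℕ) :
    Measurable (fseq α a n) := by
  induction n with
  | zero =>
    have : fseq α a 0 = fun x => ∫ y in Ioo (-a) a, Pker α a x y :=
      funext fun x => fseq_zero_eq ha0 x
    rw [this]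
    exact (StronglyMeasurable.integral_prod_right
      (measurable_Pker α a).stronglyMeasurable).measurable
  | succ n ih =>
    have : fseq α a (n + 1) = fun x => ∫ y in Ioo a 1, Pker α a x (-y) * fseq α a n y :=
      funext fun x => fseq_succ_eq ha.le n x
    rw [this]
    refine (StronglyMeasurable.integral_prod_right (Measurable.stronglyMeasurable ?_)).measurable
    have h1 : Measurable fun z : ℝ × ℝ => Pker α a z.1 (-z.2) :=
      (measurable_Pker α a).comp (measurable_fst.prodMk measurable_snd.neg)
    exact h1.mul (ih.comp measurable_snd)

lemma fseq_nonneg {α a : ℝ} (hα : α ∈ Ioo (0 : ℝ) 2) (ha : 0 < a) (n : ℕ) :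
    ∀ x ∈ Ioo a 1, 0 ≤ fseq α a n x := by
  induction n with
  | zero =>
    intro x hx
    rw [fseq_zero_eq ha]
    exact setIntegral_nonneg measurableSet_Ioo fun y hy =>
      Pker_nonneg hα hx fun h => by linarith [h.1, hy.2]
  | succ n ih =>
    intro x hx
    rw [fseq_succ_eq (hx.1.trans hx.2).le]
    exact setIntegral_nonneg measurableSet_Ioo fun y hy =>
      mul_nonneg (Pker_neg_nonneg hα ha hx hy) (ih y hy)

lemma sum_fseq_le {α a : ℝ} (hα : α ∈ Ioo (0 : ℝ) 2) (ha : 0 < a) (N : ℕ) :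
    ∀ x ∈ Ioo a 1, ∑ n ∈ Finset.range N, fseq α a n x ≤ 1 - exitBound α a x := by
  induction N with
  | zero =>
    intro x hx
    have h := Pker_mass_split hα ha hx
    have h0 := fseq_nonneg hα ha 0 x hx
    have h1 : 0 ≤ ∫ y in Ioo a 1, Pker α a x (-y) :=
      setIntegral_nonneg measurableSet_Ioo fun y hy => Pker_neg_nonneg hα ha hx hy
    simp only [fseq] at h0
    simp only [Finset.range_zero, Finset.sum_empty]
    linarith
  | succ N ih =>
    intro x hx
    have ha1 : a < 1 := hx.1.trans hx.2
    have hP := integrableOn_Pker_neg hα ha hx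
    have hle1 : ∀ y ∈ Ioo a 1, ∑ n ∈ Finset.range N, fseq α a n y ≤ 1 := fun y hy =>
      (ih y hy).trans (by linarith [exitBound_nonneg hα hy])
    have hint : ∀ n ∈ Finset.range N,
        IntegrableOn (fun y => Pker α a x (-y) * fseq α a n y) (Ioo a 1) := by
      intro n hn
      refine Integrable.mul_bdd (c := 1) hP
        (measurable_fseq ha ha1 n).aestronglyMeasurable
        ((ae_restrict_iff' measurableSet_Ioo).2 (Eventually.of_forall fun y hy => ?_))
      rw [Real.norm_of_nonneg (fseq_nonneg hα ha n y hy)]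
      exact (Finset.single_le_sum (fun i _ => fseq_nonneg hα ha i y hy) hn).trans (hle1 y hy)
    have hsum : ∑ n ∈ Finset.range N, fseq α a (n + 1) x
        ≤ ∫ y in Ioo a 1, Pker α a x (-y) := by
      simp only [fseq_succ_eq ha1.le]
      rw [← integral_finsetSum _ hint]
      refine setIntegral_mono_on (integrable_finsetSum _ hint) hP measurableSet_Ioo fun y hy => ?_
      rw [← Finset.mul_sum]
      exact mul_le_of_le_one_right (Pker_neg_nonneg hα ha hx hy) (hle1 y hy)
    have h := Pker_mass_split hα ha hx
    rw [Finset.sum_range_succ']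
    simp only [fseq] at hsum ⊢
    linarith

lemma ff_nonneg {α a x : ℝ} (hα : α ∈ Ioo (0 : ℝ) 2) (ha : 0 < a) (hx : x ∈ Ioo a 1) :
    0 ≤ ff α a x :=
  tsum_nonneg fun n => fseq_nonneg hα ha n x hx

lemma ff_le {α a x : ℝ} (hα : α ∈ Ioo (0 : ℝ) 2) (ha : 0 < a) (hx : x ∈ Ioo a 1) :
    ff α a x ≤ 1 - exitBound α a x :=
  Real.tsum_le_of_sum_range_le (fun n => fseq_nonneg hα ha n x hx)
    fun N => sum_fseq_le hα ha N x hx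

lemma Phi_neg_eq (α a y : ℝ) :
    Phi α a (-y) = ((y + a) * (y + 1)) ^ (-(α / 2)) * |y + a|⁻¹ := by
  rw [Phi, ← abs_neg (-y - a)]
  congr 2 <;> ring_nf

lemma measurable_Phi (α a : ℝ) : Measurable (Phi α a) := by
  unfold Phi
  fun_prop

lemma Phi_neg_nonneg {α a y : ℝ} (ha : 0 < a) (hy : a < y) : 0 ≤ Phi α a (-y) := by
  rw [Phi_neg_eq]
  have := ha.trans hy
  positivity

lemma Phi_nonneg_of_one_lt {α a y : ℝ} (ha : a < 1) (hy : 1 < y) : 0 ≤ Phi α a y := by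
  have h1 : 0 < y - a := by linarith
  have h2 : 0 < y - 1 := by linarith
  unfold Phi
  positivity

lemma integrableOn_Phi_neg {α a : ℝ} (hα : 0 < α) (ha : 0 < a) :
    IntegrableOn (fun y => Phi α a (-y)) (Ioi a) := by
  refine Integrable.mono' (integrableOn_Ioi_rpow_of_lt (a := -(α / 2) - 1) (by linarith) ha)
    ((measurable_Phi α a).comp measurable_neg).aestronglyMeasurable
    ((ae_restrict_iff' measurableSet_Ioi).2 (Eventually.of_forall fun y hy => ?_))
  have hy : a < y := hy
  have hy0 : 0 < y := ha.trans hy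
  rw [Real.norm_of_nonneg (Phi_neg_nonneg ha hy), Phi_neg_eq, Real.rpow_sub_one hy0.ne',
    div_eq_mul_inv, abs_of_pos (by linarith)]
  refine mul_le_mul ?_ ?_ (by positivity) (by positivity)
  · exact Real.rpow_le_rpow_of_nonpos hy0 (by nlinarith) (by linarith)
  · exact inv_anti₀ hy0 (by linarith)

lemma integrableOn_Phi {α a : ℝ} (hα : α ∈ Ioo (0 : ℝ) 2) (ha : a ∈ Ioo (0 : ℝ) 1) :
    IntegrableOn (Phi α a) (Ioi 1) := by
  obtain ⟨ha0, ha1⟩ := ha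
  have hs : -(α / 2) ≤ 0 := by linarith [hα.1]
  rw [← Ioc_union_Ioi_eq_Ioi (one_le_two : (1 : ℝ) ≤ 2)]
  refine IntegrableOn.union ?_ ?_
  · have hr : IntegrableOn (fun y : ℝ => (y - 1) ^ (-(α / 2))) (Ioc 1 2) := by
      have := (intervalIntegral.intervalIntegrable_rpow' (a := 0) (b := 1) (r := -(α / 2))
        (by linarith [hα.2])).comp_sub_right 1
      norm_num at this
      exact (intervalIntegrable_iff_integrableOn_Ioc_of_le one_le_two).1 this
    refine Integrable.mono' (hr.const_mul ((1 - a) ^ (-(α / 2)) * (1 - a)⁻¹))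
      (measurable_Phi α a).aestronglyMeasurable
      ((ae_restrict_iff' measurableSet_Ioc).2 (Eventually.of_forall fun y hy => ?_))
    have h1 : 0 < y - 1 := by linarith [hy.1]
    have h2 : 0 < 1 - a := by linarith
    rw [Real.norm_of_nonneg (Phi_nonneg_of_one_lt ha1 hy.1), Phi, mul_right_comm,
      ← Real.mul_rpow h2.le h1.le, abs_of_pos (by linarith)]
    refine mul_le_mul ?_ ?_ (inv_nonneg.2 (by linarith)) (by positivity)
    · exact Real.rpow_le_rpow_of_nonpos (by positivity) (by nlinarith) hs
    · exact inv_anti₀ h2 (by linarith)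
  · refine Integrable.mono' ((integrableOn_Ioi_rpow_of_lt (a := -(α / 2) - 1)
      (by linarith [hα.1]) two_pos).const_mul (2 * ((2 : ℝ) ^ (-(α / 2)))⁻¹))
      (measurable_Phi α a).aestronglyMeasurable
      ((ae_restrict_iff' measurableSet_Ioi).2 (Eventually.of_forall fun y hy => ?_))
    have hy : 2 < y := hy
    have hy0 : 0 < y := by linarith
    have e : 2 * ((2 : ℝ) ^ (-(α / 2)))⁻¹ * y ^ (-(α / 2) - 1)
        = (y / 2) ^ (-(α / 2)) * (y / 2)⁻¹ := by
      rw [Real.rpow_sub_one hy0.ne', Real.div_rpow hy0.le zero_le_two]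
      field_simp
    rw [Real.norm_of_nonneg (Phi_nonneg_of_one_lt ha1 (by linarith)), e, Phi,
      abs_of_pos (by linarith)]
    refine mul_le_mul ?_ ?_ (inv_nonneg.2 (by linarith)) (by positivity)
    · exact Real.rpow_le_rpow_of_nonpos (by positivity) (by nlinarith) hs
    · exact inv_anti₀ (by positivity) (by linarith)

lemma integrableOn_Phi_neg_mul_exitBound {α a : ℝ} (hα : α ∈ Ioo (0 : ℝ) 2) (ha : 0 < a) :
    IntegrableOn (fun y => Phi α a (-y) * exitBound α a y) (Ioo a 1) := by
  have hm : Measurable (exitBound α a) := by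
    unfold exitBound
    fun_prop
  refine Integrable.mul_bdd (c := 1)
    ((integrableOn_Phi_neg hα.1 ha).mono_set Ioo_subset_Ioi_self) hm.aestronglyMeasurable
    ((ae_restrict_iff' measurableSet_Ioo).2 (Eventually.of_forall fun y hy => ?_))
  rw [Real.norm_of_nonneg (exitBound_nonneg hα hy)]
  linarith [ff_le hα ha hy, ff_nonneg hα ha hy]

lemma integral_exitBound_le {α a : ℝ} (hα : α ∈ Ioo (0 : ℝ) 2) (ha : a ∈ Ioo (0 : ℝ) 1) :
    ∫ y in Ioo a 1, Phi α a (-y) * exitBound α a y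
      ≤ (∫ y in Ioi a, Phi α a (-y)) - ∫ y in a..(1:ℝ), Phi α a (-y) * ff α a y := by
  obtain ⟨ha0, ha1⟩ := ha
  have hΦ := integrableOn_Phi_neg hα.1 ha0
  have hΦ1 := hΦ.mono_set (Ioo_subset_Ioi_self : Ioo a 1 ⊆ Ioi a)
  have hE := integrableOn_Phi_neg_mul_exitBound hα ha0
  have h1 : ∫ y in Ioo a 1, Phi α a (-y) ≤ ∫ y in Ioi a, Phi α a (-y) :=
    setIntegral_mono_set hΦ ((ae_restrict_iff' measurableSet_Ioi).2
      (Eventually.of_forall fun y hy => Phi_neg_nonneg ha0 hy)) Ioo_subset_Ioi_self.eventuallyLE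
  have h2 : ∫ y in a..(1:ℝ), Phi α a (-y) * ff α a y
      ≤ ∫ y in Ioo a 1, (Phi α a (-y) - Phi α a (-y) * exitBound α a y) := by
    rw [intervalIntegral.integral_of_le ha1.le, integral_Ioc_eq_integral_Ioo]
    refine integral_mono_of_nonneg ((ae_restrict_iff' measurableSet_Ioo).2
      (Eventually.of_forall fun y hy => ?_)) (hΦ1.sub hE) ((ae_restrict_iff' measurableSet_Ioo).2
      (Eventually.of_forall fun y hy => ?_))
    · exact mul_nonneg (Phi_neg_nonneg ha0 hy.1) (ff_nonneg hα ha0 hy)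
    · have := mul_le_mul_of_nonneg_left (ff_le hα ha0 hy) (Phi_neg_nonneg (α := α) ha0 hy.1)
      linarith
  rw [integral_sub hΦ1 hE] at h2
  linarith

lemma integral_Phi_nonneg {α a : ℝ} (ha : a < 1) : 0 ≤ ∫ y in Ioi (1 : ℝ), Phi α a y :=
  setIntegral_nonneg measurableSet_Ioi fun _ hy => Phi_nonneg_of_one_lt ha hy

lemma integral_Phi_neg_mul_exitBound_nonneg {α a : ℝ} (hα : α ∈ Ioo (0 : ℝ) 2) (ha : 0 < a) :
    0 ≤ ∫ y in Ioo a 1, Phi α a (-y) * exitBound α a y :=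
  setIntegral_nonneg measurableSet_Ioo fun _ hy =>
    mul_nonneg (Phi_neg_nonneg ha hy.1) (exitBound_nonneg hα hy)

lemma rpow_neg_le_Psi {α a : ℝ} (hα : α ∈ Ioo (0 : ℝ) 2) (ha : a ∈ Ioo (0 : ℝ) 1) :
    Cc α * 2 ^ (-(α / 2)) / 2 * (1 - a) ^ (-(α / 2)) ≤ Psi α a := by
  have h1 : 0 < 1 - a := by linarith [ha.2]
  have hC := Cc_pos hα
  have hA : (2 * (1 - a) ^ 2) ^ (-(α / 2)) / 2 ≤ ∫ y in Ioi (1 : ℝ), Phi α a y := by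
    calc (2 * (1 - a) ^ 2) ^ (-(α / 2)) / 2
        = ∫ y in Ioc 1 (2 - a), (2 * (1 - a) ^ 2) ^ (-(α / 2)) * (2 * (1 - a))⁻¹ := by
          simp only [integral_const, measureReal_restrict_apply_univ, Real.volume_real_Ioc,
            smul_eq_mul]
          rw [max_eq_left (by linarith)]
          field_simp
          ring
      _ ≤ ∫ y in Ioc 1 (2 - a), Phi α a y := by
          refine setIntegral_mono_on (integrable_const _)
            ((integrableOn_Phi hα ha).mono_set Ioc_subset_Ioi_self) measurableSet_Ioc
            fun y hy => ?_
          have h2 : 0 < y - 1 := by linarith [hy.1]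
          have h3 : 0 < y - a := by linarith
          rw [Phi, abs_of_pos h3]
          refine mul_le_mul ?_ ?_ (by positivity) (by positivity)
          · refine Real.rpow_le_rpow_of_nonpos (by positivity) ?_ (by linarith [hα.1])
            calc (y - a) * (y - 1) ≤ (2 * (1 - a)) * (1 - a) :=
                  mul_le_mul (by linarith [hy.2]) (by linarith [hy.2]) h2.le (by positivity)
              _ = 2 * (1 - a) ^ 2 := by ring
          · exact inv_anti₀ h3 (by linarith [hy.2])
      _ ≤ _ := setIntegral_mono_set (integrableOn_Phi hα ha)
          ((ae_restrict_iff' measurableSet_Ioi).2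
          (Eventually.of_forall fun y hy => Phi_nonneg_of_one_lt ha.2 hy))
          Ioc_subset_Ioi_self.eventuallyLE
  have hBD := (integral_Phi_neg_mul_exitBound_nonneg hα ha.1).trans (integral_exitBound_le hα ha)
  calc _ = Cc α * (1 - a) ^ (α / 2) * ((2 * (1 - a) ^ 2) ^ (-(α / 2)) / 2) := by
        rw [Real.mul_rpow zero_le_two (by positivity), sq, Real.mul_rpow h1.le h1.le]
        have : (1 - a) ^ (α / 2) * (1 - a) ^ (-(α / 2)) = 1 := by
          rw [← Real.rpow_add h1, add_neg_cancel, Real.rpow_zero]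
        linear_combination (-(Cc α * 2 ^ (-(α / 2)) / 2 * (1 - a) ^ (-(α / 2)))) * this
    _ ≤ Psi α a := by
        unfold Psi
        gcongr
        linarith

lemma log_le_Psi {α a : ℝ} (hα : α ∈ Ioo (0 : ℝ) 2) (ha : a ∈ Ioo (0 : ℝ) (1 / 4)) :
    Cc α * 2⁻¹ ^ (α / 2) * (Cc α * 96⁻¹ ^ (α / 2) / 6 * -Real.log (4 * a)) ≤ Psi α a := by
  obtain ⟨ha0, ha1⟩ := ha
  have haI : a ∈ Ioo (0 : ℝ) 1 := ⟨ha0, by linarith⟩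
  have hC := Cc_pos hα
  have hα2 : 0 ≤ α / 2 := by linarith [hα.1]
  have hle : 2 * a ≤ 1 / 2 := by linarith
  set c := Cc α * 96⁻¹ ^ (α / 2) / 6
  have hlog : c * -Real.log (4 * a) = ∫ y in Ioo (2 * a) (1 / 2), c * y⁻¹ := by
    rw [← integral_Ioc_eq_integral_Ioo, ← intervalIntegral.integral_of_le hle,
      intervalIntegral.integral_const_mul, integral_inv_of_pos (by linarith) (by norm_num),
      ← Real.log_inv]
    congr 2
    field_simp
    norm_num
  have hinv : IntegrableOn (fun y : ℝ => c * y⁻¹) (Ioo (2 * a) (1 / 2)) := by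
    have : IntervalIntegrable (fun y : ℝ => c * y⁻¹) volume (2 * a) (1 / 2) :=
      (intervalIntegral.intervalIntegrable_inv (fun y hy => by
        rw [uIcc_of_le hle] at hy
        have : 0 < y := by linarith [hy.1]
        exact this.ne') continuousOn_id).const_mul c
    exact ((intervalIntegrable_iff_integrableOn_Ioc_of_le hle).1 this).mono_set
      Ioo_subset_Ioc_self
  have hsub : Ioo (2 * a) (1 / 2) ⊆ Ioo a 1 := Ioo_subset_Ioo (by linarith) (by norm_num)
  have hE := integrableOn_Phi_neg_mul_exitBound hα ha0
  have hlow : c * -Real.log (4 * a) ≤ ∫ y in Ioo a 1, Phi α a (-y) * exitBound α a y := by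
    rw [hlog]
    refine (setIntegral_mono_on hinv (hE.mono_set hsub) measurableSet_Ioo fun y hy => ?_).trans
      (setIntegral_mono_set hE ((ae_restrict_iff' measurableSet_Ioo).2
        (Eventually.of_forall fun y hy => mul_nonneg (Phi_neg_nonneg ha0 hy.1)
        (exitBound_nonneg hα hy))) hsub.eventuallyLE)
    have hy0 : 0 < y := by linarith [hy.1]
    have e : c * y⁻¹ = ((4 * y) ^ (-(α / 2)) * (2 * y)⁻¹)
        * (Cc α * (y / 24) ^ (α / 2) * 3⁻¹) := by
      have : (96⁻¹ : ℝ) ^ (α / 2) = (4 * y) ^ (-(α / 2)) * (y / 24) ^ (α / 2) := by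
        rw [Real.rpow_neg (by positivity), ← Real.inv_rpow (by positivity),
          ← Real.mul_rpow (by positivity) (by positivity)]
        congr 1
        field_simp
        norm_num
      simp only [c]
      rw [this]
      field_simp
      norm_num
    rw [e, Phi_neg_eq, exitBound, abs_of_pos (by linarith)]
    have i1 : (4 * y) ^ (-(α / 2)) ≤ ((y + a) * (y + 1)) ^ (-(α / 2)) :=
      Real.rpow_le_rpow_of_nonpos (by positivity) (by nlinarith [hy.1, hy.2]) (by linarith)
    have i2 : (2 * y)⁻¹ ≤ (y + a)⁻¹ := inv_anti₀ (by linarith) (by linarith [hy.1])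
    have i3 : (y / 24) ^ (α / 2) ≤ ((y - a) * (1 - y) / 6) ^ (α / 2) :=
      Real.rpow_le_rpow (by positivity) (by nlinarith [hy.1, hy.2]) hα2
    gcongr
  have hA := integral_Phi_nonneg (α := α) haI.2
  have hBD := integral_exitBound_le hα haI
  have hlogneg : 0 ≤ -Real.log (4 * a) := by
    have := Real.log_nonpos (x := 4 * a) (by linarith) (by linarith)
    linarith
  have hc : 0 ≤ c := by positivity
  unfold Psi
  have i4 : (2⁻¹ : ℝ) ^ (α / 2) ≤ (1 - a) ^ (α / 2) :=
    Real.rpow_le_rpow (by norm_num) (by linarith) hα2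
  have i5 : 0 ≤ c * -Real.log (4 * a) := mul_nonneg hc hlogneg
  refine mul_le_mul (mul_le_mul_of_nonneg_left i4 hC.le) (by linarith) i5 ?_
  exact mul_nonneg hC.le (Real.rpow_nonneg (by linarith) _)

/-- `lim_{a→0⁺} Ψ(a) = ∞` and `lim_{a→1⁻} Ψ(a) = ∞`. -/
theorem Psi_tendsto_atTop (α : ℝ) (hα : α ∈ Set.Ioo (0:ℝ) 2) :
    Tendsto (Psi α) (nhdsWithin 0 (Set.Ioo (0:ℝ) 1)) atTop ∧
    Tendsto (Psi α) (nhdsWithin 1 (Set.Ioo (0:ℝ) 1)) atTop := by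
  have hC := Cc_pos hα
  constructor
  · have h4 : Tendsto (fun a : ℝ => 4 * a) (nhdsWithin 0 (Ioo (0 : ℝ) 1))
        (nhdsWithin 0 (Ioi 0)) := by
      refine tendsto_nhdsWithin_iff.2 ⟨?_, eventually_nhdsWithin_of_forall fun a ha => ?_⟩
      · have : Continuous fun a : ℝ => 4 * a := by fun_prop
        simpa using (this.tendsto 0).mono_left nhdsWithin_le_nhds
      · exact mul_pos four_pos ha.1
    have hlog := tendsto_neg_atBot_atTop.comp (Real.tendsto_log_nhdsGT_zero.comp h4)
    refine tendsto_atTop_mono' _ ?_ ((hlog.const_mul_atTop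
      (r := Cc α * 96⁻¹ ^ (α / 2) / 6) (by positivity)).const_mul_atTop
      (r := Cc α * 2⁻¹ ^ (α / 2)) (by positivity))
    filter_upwards [self_mem_nhdsWithin,
      mem_nhdsWithin_of_mem_nhds (Iio_mem_nhds (show (0 : ℝ) < 1 / 4 by norm_num))] with a h1 h2
    exact log_le_Psi hα ⟨h1.1, h2⟩
  · have h1 : Tendsto (fun a : ℝ => 1 - a) (nhdsWithin 1 (Ioo (0 : ℝ) 1))
        (nhdsWithin 0 (Ioi 0)) := by
      refine tendsto_nhdsWithin_iff.2 ⟨?_, eventually_nhdsWithin_of_forall fun a ha => ?_⟩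
      · have : Continuous fun a : ℝ => 1 - a := by fun_prop
        simpa using (this.tendsto 1).mono_left nhdsWithin_le_nhds
      · exact sub_pos.2 ha.2
    have hpow := (tendsto_rpow_neg_nhdsGT_zero
      (show -(α / 2) < 0 by linarith [hα.1])).comp h1
    refine tendsto_atTop_mono' _ ?_ (hpow.const_mul_atTop
      (r := Cc α * 2 ^ (-(α / 2)) / 2) (by positivity))
    filter_upwards [self_mem_nhdsWithin] with a ha
    exact rpow_neg_le_Psi hα ha
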